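/- Let 1 ≤ m < n, k ∈ {1,…,n−1}, and set β = 1 − C_m^k/C_n^k (with C_m^k = 0 if m < k). Let u(z',z'') = (1+|z'|²)|z''|^{2β} on ℂ^m × ℂ^{n−m} and N = {z : z'' = 0}. Then there is a function ψ ∈ C^∞(ℂⁿ) with ψ > 0 on ℂⁿ such that MA_k(λ((D²_ℂ u)(z))) = ψ(z) for every z ∈ ℂⁿ ∖ N; in particular MA_k(λ(D²_ℂ u)) extends to a function in C^∞(ℂⁿ) which is strictly positive on all of ℂⁿ. More generally, for any β > 0, on ℂⁿ ∖ N one has MA_k(λ(D²_ℂ u)) = ψ(z) |z''|^{2β C_m^k + (2β−2)(C_n^k − C_m^k)} for some smooth positive function ψ on ℂⁿ. -/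

import Mathlib

open scoped ComplexOrder

noncomputable section

/-- The direction `∂/∂xᵢ` in `ℂⁿ`. -/
def ex {n : ℕ} (i : Fin n) : Fin n → ℂ := Pi.single i 1
/-- The direction `∂/∂yᵢ` in `ℂⁿ`. -/
def ey {n : ℕ} (i : Fin n) : Fin n → ℂ := Pi.single i Complex.I

/-- Second directional (real) derivative `∂_v ∂_w u`. -/
def dd2 {n : ℕ} (u : (Fin n → ℂ) → ℝ) (z v w : Fin n → ℂ) : ℝ :=
  fderiv ℝ (fun y => fderiv ℝ u y w) z v

/-- The complex Hessian `(∂²u/∂zᵢ∂z̄ⱼ)_{i,j}`, expressed through real second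
derivatives: `∂²u/∂zᵢ∂z̄ⱼ = (1/4)[∂xᵢ∂xⱼu + ∂yᵢ∂yⱼu + i(∂xᵢ∂yⱼu − ∂yᵢ∂xⱼu)]`. -/
def complexHessian {n : ℕ} (u : (Fin n → ℂ) → ℝ) (z : Fin n → ℂ) :
    Matrix (Fin n) (Fin n) ℂ :=
  Matrix.of fun i j =>
    (((dd2 u z (ex i) (ex j) + dd2 u z (ey i) (ey j) : ℝ) : ℂ)
      + Complex.I * ((dd2 u z (ex i) (ey j) - dd2 u z (ey i) (ex j) : ℝ) : ℂ)) / 4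

/-- `|z'|²`: squared norm of the first `m` coordinates. -/
def nsqFirst {n : ℕ} (m : ℕ) (z : Fin n → ℂ) : ℝ :=
  ∑ i ∈ Finset.univ.filter (fun i : Fin n => (i : ℕ) < m), Complex.normSq (z i)

/-- `|z''|²`: squared norm of the last `n − m` coordinates. -/
def nsqLast {n : ℕ} (m : ℕ) (z : Fin n → ℂ) : ℝ :=
  ∑ i ∈ Finset.univ.filter (fun i : Fin n => m ≤ (i : ℕ)), Complex.normSq (z i)

/-- The Pogorelov-type example `u(z',z'') = (1+|z'|²)·|z''|^{2β}`. -/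
def pogorelov {n : ℕ} (m : ℕ) (β : ℝ) (z : Fin n → ℂ) : ℝ :=
  (1 + nsqFirst m z) * Real.sqrt (nsqLast m z) ^ (2 * β)

/-- The singular set `N = {z : z'' = 0}`. -/
def singSet (n m : ℕ) : Set (Fin n → ℂ) := {z | ∀ i : Fin n, m ≤ (i : ℕ) → z i = 0}


/-- The eigenvalues of a Hermitian matrix, sorted in nondecreasing order
(junk value `0` if the matrix is not Hermitian). -/
def sortedEigs {n : ℕ} (A : Matrix (Fin n) (Fin n) ℂ) : Fin n → ℝ :=
  if h : A.IsHermitian then h.eigenvalues ∘ Tuple.sort h.eigenvalues else 0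

/-- The `k`-Monge–Ampère polynomial `MA_k(λ) = ∏_{1 ≤ i₁<…<i_k ≤ n} (λ_{i₁}+…+λ_{i_k})`. -/
def MAk (n k : ℕ) (lam : Fin n → ℝ) : ℝ :=
  ∏ s ∈ Finset.powersetCard k (Finset.univ : Finset (Fin n)), ∑ i ∈ s, lam i

section Derivatives

variable {n : ℕ}

/-- The squared Euclidean norm of the coordinates indexed by `S`. -/
def nsqOn (S : Finset (Fin n)) (z : Fin n → ℂ) : ℝ := ∑ i ∈ S, Complex.normSq (z i)

/-- The derivative of `nsqOn S` at `z`. -/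
def nsqOnDeriv (S : Finset (Fin n)) (z : Fin n → ℂ) : (Fin n → ℂ) →L[ℝ] ℝ :=
  ∑ i ∈ S, ((2 * (z i).re) • Complex.reCLM.comp (ContinuousLinearMap.proj i)
    + (2 * (z i).im) • Complex.imCLM.comp (ContinuousLinearMap.proj i))

lemma nsqOnDeriv_apply (S : Finset (Fin n)) (z w : Fin n → ℂ) :
    nsqOnDeriv S z w = ∑ i ∈ S, (2 * (z i).re * (w i).re + 2 * (z i).im * (w i).im) := by
  simp [nsqOnDeriv]

lemma nsqOnDeriv_comm (S : Finset (Fin n)) (z w : Fin n → ℂ) :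
    nsqOnDeriv S z w = nsqOnDeriv S w z := by
  simp only [nsqOnDeriv_apply]
  exact Finset.sum_congr rfl fun i _ => by ring

lemma hasFDerivAt_nsqOn (S : Finset (Fin n)) (z : Fin n → ℂ) :
    HasFDerivAt (nsqOn S) (nsqOnDeriv S z) z := by
  unfold nsqOn nsqOnDeriv
  refine HasFDerivAt.fun_sum fun i _ => ?_
  have hre : HasFDerivAt (fun y : Fin n → ℂ => (y i).re)
      (Complex.reCLM.comp (ContinuousLinearMap.proj i)) z :=
    (Complex.reCLM.comp (ContinuousLinearMap.proj (R := ℝ) (φ := fun _ : Fin n => ℂ) i)).hasFDerivAt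
  have him : HasFDerivAt (fun y : Fin n → ℂ => (y i).im)
      (Complex.imCLM.comp (ContinuousLinearMap.proj i)) z :=
    (Complex.imCLM.comp (ContinuousLinearMap.proj (R := ℝ) (φ := fun _ : Fin n => ℂ) i)).hasFDerivAt
  simp only [Complex.normSq_apply]
  refine ((hre.mul hre).add (him.mul him)).congr_fderiv ?_
  ext w
  simp
  ring

lemma hasFDerivAt_nsqOnDeriv (S : Finset (Fin n)) (z w : Fin n → ℂ) :
    HasFDerivAt (fun y => nsqOnDeriv S y w) (nsqOnDeriv S w) z := by
  simp only [nsqOnDeriv_comm S _ w]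
  exact (nsqOnDeriv S w).hasFDerivAt

lemma contDiff_nsqOn (S : Finset (Fin n)) : ContDiff ℝ (⊤ : ℕ∞) (nsqOn S) := by
  unfold nsqOn
  simp only [Complex.normSq_apply]
  refine ContDiff.sum fun i _ => ?_
  have hre : ContDiff ℝ (⊤ : ℕ∞) (fun y : Fin n → ℂ => (y i).re) :=
    (Complex.reCLM.comp (ContinuousLinearMap.proj (R := ℝ) (φ := fun _ : Fin n => ℂ) i)).contDiff
  have him : ContDiff ℝ (⊤ : ℕ∞) (fun y : Fin n → ℂ => (y i).im) :=
    (Complex.imCLM.comp (ContinuousLinearMap.proj (R := ℝ) (φ := fun _ : Fin n => ℂ) i)).contDiff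
  exact (hre.mul hre).add (him.mul him)

lemma nsqOn_nonneg (S : Finset (Fin n)) (z : Fin n → ℂ) : 0 ≤ nsqOn S z :=
  Finset.sum_nonneg fun _ _ => Complex.normSq_nonneg _

lemma nsqOnDeriv_ex (S : Finset (Fin n)) (z : Fin n → ℂ) (j : Fin n) :
    nsqOnDeriv S z (ex j) = if j ∈ S then 2 * (z j).re else 0 := by
  rw [nsqOnDeriv_apply, ← Finset.sum_ite_eq S j fun j => 2 * (z j).re]
  refine Finset.sum_congr rfl fun i _ => ?_
  rcases eq_or_ne j i with rfl | h
  · simp [ex]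
  · simp [ex, h]

lemma nsqOnDeriv_ey (S : Finset (Fin n)) (z : Fin n → ℂ) (j : Fin n) :
    nsqOnDeriv S z (ey j) = if j ∈ S then 2 * (z j).im else 0 := by
  rw [nsqOnDeriv_apply, ← Finset.sum_ite_eq S j fun j => 2 * (z j).im]
  refine Finset.sum_congr rfl fun i _ => ?_
  rcases eq_or_ne j i with rfl | h
  · simp [ey]
  · simp [ey, h]

/-- The function `(1 + |z_S|²) |z_R|^{2β}` for index sets `S` and `R`. -/
def prodPow (S R : Finset (Fin n)) (β : ℝ) (z : Fin n → ℂ) : ℝ :=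
  (1 + nsqOn S z) * Real.sqrt (nsqOn R z) ^ (2 * β)

lemma hasFDerivAt_nsqOn_rpow (R : Finset (Fin n)) (p : ℝ) {z : Fin n → ℂ} (hz : 0 < nsqOn R z) :
    HasFDerivAt (fun y => nsqOn R y ^ p)
      ((p * nsqOn R z ^ (p - 1)) • nsqOnDeriv R z) z :=
  (hasFDerivAt_nsqOn R z).rpow_const (Or.inl hz.ne')

lemma eventually_nsqOn_pos (R : Finset (Fin n)) {z : Fin n → ℂ} (hz : 0 < nsqOn R z) :
    ∀ᶠ y in nhds z, 0 < nsqOn R y :=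
  (contDiff_nsqOn R).continuous.continuousAt.eventually (lt_mem_nhds hz)

lemma sqrt_rpow_two_mul {x : ℝ} (hx : 0 ≤ x) (p : ℝ) : Real.sqrt x ^ (2 * p) = x ^ p := by
  rw [Real.rpow_mul (Real.sqrt_nonneg x), Real.rpow_two, Real.sq_sqrt hx]

lemma fderiv_prodPow (S R : Finset (Fin n)) (β : ℝ) {z : Fin n → ℂ} (hz : 0 < nsqOn R z)
    (w : Fin n → ℂ) :
    fderiv ℝ (prodPow S R β) z w = nsqOn R z ^ β * nsqOnDeriv S z w
      + (1 + nsqOn S z) * (β * nsqOn R z ^ (β - 1)) * nsqOnDeriv R z w := by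
  have h : prodPow S R β = fun y => (1 + nsqOn S y) * nsqOn R y ^ β := by
    funext y
    rw [prodPow, sqrt_rpow_two_mul (nsqOn_nonneg R y)]
  have h' := ((hasFDerivAt_nsqOn S z).const_add 1).fun_mul (hasFDerivAt_nsqOn_rpow R β hz)
  rw [h, h'.fderiv]
  simp
  ring

lemma dd2_prodPow (S R : Finset (Fin n)) (β : ℝ) {z : Fin n → ℂ} (hz : 0 < nsqOn R z)
    (v w : Fin n → ℂ) :
    dd2 (prodPow S R β) z v w = nsqOn R z ^ β * nsqOnDeriv S w v
      + β * nsqOn R z ^ (β - 1)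
        * (nsqOnDeriv S z w * nsqOnDeriv R z v + nsqOnDeriv S z v * nsqOnDeriv R z w)
      + (1 + nsqOn S z) * β * (β - 1) * nsqOn R z ^ (β - 2)
        * (nsqOnDeriv R z v * nsqOnDeriv R z w)
      + (1 + nsqOn S z) * β * nsqOn R z ^ (β - 1) * nsqOnDeriv R w v := by
  have h : (fun y => fderiv ℝ (prodPow S R β) y w) =ᶠ[nhds z]
      fun y => nsqOn R y ^ β * nsqOnDeriv S y w
        + (1 + nsqOn S y) * (β * nsqOn R y ^ (β - 1)) * nsqOnDeriv R y w := by
    filter_upwards [eventually_nsqOn_pos R hz] with y hy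
    exact fderiv_prodPow S R β hy w
  have h' := ((hasFDerivAt_nsqOn_rpow R β hz).fun_mul (hasFDerivAt_nsqOnDeriv S z w)).fun_add
    ((((hasFDerivAt_nsqOn S z).const_add 1).fun_mul
      ((hasFDerivAt_nsqOn_rpow R (β - 1) hz).const_mul β)).fun_mul (hasFDerivAt_nsqOnDeriv R z w))
  rw [dd2, h.fderiv_eq, h'.fderiv]
  simp
  rw [show β - 1 - 1 = β - 2 by ring]
  ring

lemma complexHessian_prodPow {S R : Finset (Fin n)} (hSR : Disjoint S R) (hun : S ∪ R = Finset.univ)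
    (β : ℝ) {z : Fin n → ℂ} (hz : 0 < nsqOn R z) (i j : Fin n) :
    complexHessian (prodPow S R β) z i j =
      (if i = j then if i ∈ S then ((nsqOn R z ^ β : ℝ) : ℂ)
          else (((1 + nsqOn S z) * β * nsqOn R z ^ (β - 1) : ℝ) : ℂ) else 0)
      + (if i ∈ S then if j ∈ S then 0 else ((β * nsqOn R z ^ (β - 1) : ℝ) : ℂ)
          else if j ∈ S then ((β * nsqOn R z ^ (β - 1) : ℝ) : ℂ)
          else (((1 + nsqOn S z) * β * (β - 1) * nsqOn R z ^ (β - 2) : ℝ) : ℂ))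
        * (star (z i) * z j) := by
  have hR : ∀ i, i ∈ R ↔ i ∉ S := fun i =>
    ⟨fun h h' => Finset.disjoint_left.1 hSR h' h,
      fun h => (Finset.mem_union.1 (hun ▸ Finset.mem_univ i)).resolve_left h⟩
  rw [complexHessian, Matrix.of_apply]
  simp only [dd2_prodPow S R β hz, nsqOnDeriv_ex, nsqOnDeriv_ey, hR]
  generalize nsqOn R z ^ β = p
  generalize nsqOn R z ^ (β - 1) = q
  generalize nsqOn R z ^ (β - 2) = r
  generalize nsqOn S z = a
  rcases eq_or_ne i j with rfl | hij
  · by_cases hi : i ∈ S <;>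
    · simp [hi, ex, ey]
      apply Complex.ext <;> simp <;> ring
  · by_cases hi : i ∈ S <;> by_cases hj : j ∈ S <;>
    · simp [hi, hj, hij, ex, ey]
      try (apply Complex.ext <;> simp <;> ring)

end Derivatives

section Eigenvalues

variable {n : ℕ}

lemma MAk_eq_multiset (k : ℕ) (lam : Fin n → ℝ) :
    MAk n k lam =
      ((((Finset.univ : Finset (Fin n)).val.map lam).powersetCard k).map Multiset.sum).prod := by
  rw [MAk, Multiset.powersetCard_map, ← Finset.map_val_val_powersetCard, Multiset.map_map,
    Multiset.map_map]
  rfl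

lemma sortedEigs_multiset {A : Matrix (Fin n) (Fin n) ℂ} (hA : A.IsHermitian) :
    (Finset.univ : Finset (Fin n)).val.map (sortedEigs A)
      = (Finset.univ : Finset (Fin n)).val.map hA.eigenvalues := by
  rw [sortedEigs, dif_pos hA, ← Multiset.map_map]
  congr 1
  exact Multiset.map_univ_val_equiv _

lemma MAk_sortedEigs (k : ℕ) {A : Matrix (Fin n) (Fin n) ℂ} (hA : A.IsHermitian) {lam : Fin n → ℝ}
    (h : A.charpoly = ∏ i, (Polynomial.X - Polynomial.C (lam i : ℂ))) :
    MAk n k (sortedEigs A) = MAk n k lam := by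
  have h1 : A.charpoly.roots = (Finset.univ : Finset (Fin n)).val.map (fun i => (lam i : ℂ)) := by
    rw [h]
    exact Polynomial.roots_multiset_prod_X_sub_C
      ((Finset.univ : Finset (Fin n)).val.map fun i => (lam i : ℂ)) ▸ by
        rw [Multiset.map_map]; rfl
  rw [hA.roots_charpoly_eq_eigenvalues] at h1
  have h2 := congrArg (Multiset.map Complex.re) h1
  rw [Multiset.map_map, Multiset.map_map] at h2
  rw [MAk_eq_multiset, MAk_eq_multiset, sortedEigs_multiset hA]
  exact congrArg (fun M => ((Multiset.powersetCard k M).map Multiset.sum).prod) h2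

/-- A Hermitian matrix which is a two-valued diagonal matrix plus a perturbation of rank two
whose range is spanned by the restrictions of `star z` to `S` and to its complement. -/
def blockPerturb (S : Finset (Fin n)) (l₁ l₂ c d : ℝ) (z : Fin n → ℂ) :
    Matrix (Fin n) (Fin n) ℂ :=
  Matrix.of fun i j => (if i = j then if i ∈ S then (l₁ : ℂ) else (l₂ : ℂ) else 0)
    + (if i ∈ S then if j ∈ S then 0 else (c : ℂ) else if j ∈ S then (c : ℂ) else (d : ℂ))
      * (star (z i) * z j)

lemma isHermitian_blockPerturb (S : Finset (Fin n)) (l₁ l₂ c d : ℝ) (z : Fin n → ℂ) :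
    (blockPerturb S l₁ l₂ c d z).IsHermitian := by
  ext i j
  simp only [Matrix.conjTranspose_apply, blockPerturb, Matrix.of_apply]
  rcases eq_or_ne i j with rfl | hij
  · by_cases hi : i ∈ S <;> simp [hi, mul_comm]
  · by_cases hi : i ∈ S <;> by_cases hj : j ∈ S <;> simp [hi, hj, hij, hij.symm, mul_comm]

lemma det_scalar_sub_blockPerturb (S : Finset (Fin n)) (l₁ l₂ c d : ℝ) (z : Fin n → ℂ) {x : ℂ}
    (h₁ : x - l₁ ≠ 0) (h₂ : x - l₂ ≠ 0) :
    (Matrix.scalar (Fin n) x - blockPerturb S l₁ l₂ c d z).det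
      = (∏ i, (x - if i ∈ S then (l₁ : ℂ) else l₂))
        * (1 - d * nsqOn Sᶜ z / (x - l₂)
            - c ^ 2 * nsqOn S z * nsqOn Sᶜ z / ((x - l₁) * (x - l₂))) := by
  let D : Fin n → ℂ := fun i => x - if i ∈ S then (l₁ : ℂ) else l₂
  let U : Matrix (Fin n) (Fin 2) ℂ :=
    Matrix.of fun i => ![if i ∈ S then star (z i) else 0, if i ∈ S then 0 else star (z i)]
  let V : Matrix (Fin 2) (Fin n) ℂ := Matrix.of
    ![fun j => if j ∈ S then 0 else -(c * z j), fun j => if j ∈ S then -(c * z j) else -(d * z j)]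
  have hD : ∀ i, D i ≠ 0 := fun i => by by_cases hi : i ∈ S <;> simpa [D, hi]
  have hdet : (Matrix.diagonal D).det = ∏ i, D i := Matrix.det_diagonal
  have hinv : (Matrix.diagonal D)⁻¹ = Matrix.diagonal fun i => (D i)⁻¹ := by
    refine Matrix.inv_eq_right_inv ?_
    rw [Matrix.diagonal_mul_diagonal, ← Matrix.diagonal_one]
    congr 1
    funext i
    exact mul_inv_cancel₀ (hD i)
  have hsplit : Matrix.scalar (Fin n) x - blockPerturb S l₁ l₂ c d z
      = Matrix.diagonal D + U * V := by
    ext i j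
    simp only [Matrix.sub_apply, Matrix.add_apply, Matrix.scalar_apply, Matrix.diagonal_apply,
      blockPerturb, Matrix.of_apply, Matrix.mul_apply, Fin.sum_univ_two, D, U, V]
    rcases eq_or_ne i j with rfl | hij
    · by_cases hi : i ∈ S <;> simp [hi]
      ring
    · by_cases hi : i ∈ S <;> by_cases hj : j ∈ S <;> simp [hi, hj, hij] <;> ring
  have hunit : IsUnit (Matrix.diagonal D).det := by
    rw [hdet]
    exact (Finset.prod_ne_zero_iff.2 fun i _ => hD i).isUnit
  have hsum : ∀ (T : Finset (Fin n)) (e : ℂ),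
      ∑ i, (if i ∈ T then e * (star (z i) * z i) else 0) = e * nsqOn T z := by
    intro T e
    rw [Finset.sum_ite_mem, Finset.univ_inter, ← Finset.mul_sum, nsqOn, Complex.ofReal_sum]
    congr 1
    refine Finset.sum_congr rfl fun i _ => ?_
    rw [Complex.normSq_eq_conj_mul_self]
    rfl
  have hent : ∀ a b, (V * Matrix.diagonal (fun i => (D i)⁻¹) * U) a b
      = ∑ i, V a i * (D i)⁻¹ * U i b := fun a b => by
    rw [Matrix.mul_apply]
    simp only [Matrix.mul_diagonal]
  have e00 : (V * Matrix.diagonal (fun i => (D i)⁻¹) * U) 0 0 = 0 := by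
    rw [hent]
    refine Finset.sum_eq_zero fun i _ => ?_
    by_cases hi : i ∈ S <;> simp [U, V, hi]
  have e01 : (V * Matrix.diagonal (fun i => (D i)⁻¹) * U) 0 1
      = -(c / (x - l₂)) * nsqOn Sᶜ z := by
    rw [hent, ← hsum]
    refine Finset.sum_congr rfl fun i _ => ?_
    by_cases hi : i ∈ S <;> simp [U, V, D, hi]
    ring
  have e10 : (V * Matrix.diagonal (fun i => (D i)⁻¹) * U) 1 0
      = -(c / (x - l₁)) * nsqOn S z := by
    rw [hent, ← hsum]
    refine Finset.sum_congr rfl fun i _ => ?_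
    by_cases hi : i ∈ S <;> simp [U, V, D, hi]
    ring
  have e11 : (V * Matrix.diagonal (fun i => (D i)⁻¹) * U) 1 1
      = -(d / (x - l₂)) * nsqOn Sᶜ z := by
    rw [hent, ← hsum]
    refine Finset.sum_congr rfl fun i _ => ?_
    by_cases hi : i ∈ S <;> simp [U, V, D, hi]
    ring
  rw [hsplit, Matrix.det_add_mul U V hunit, hdet, hinv, Matrix.det_fin_two]
  simp only [Matrix.add_apply, e00, e01, e10, e11, Matrix.one_apply_eq,
    Matrix.one_apply_ne (show (0 : Fin 2) ≠ 1 by decide),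
    Matrix.one_apply_ne (show (1 : Fin 2) ≠ 0 by decide), D]
  congr 1
  field_simp
  ring

/-- The two-valued function `l₁` on `S`, `l₂` off `S`, modified to `μ₁` at `p` and `μ₂` at `q`. -/
def twoValued (S : Finset (Fin n)) (p q : Fin n) (l₁ l₂ μ₁ μ₂ : ℝ) (i : Fin n) : ℝ :=
  if i = p then μ₁ else if i = q then μ₂ else if i ∈ S then l₁ else l₂

lemma charpoly_blockPerturb {S : Finset (Fin n)} {p q : Fin n} (hp : p ∈ S) (hq : q ∉ S)
    (l₁ l₂ c d : ℝ) (z : Fin n → ℂ) {μ₁ μ₂ : ℝ} (hadd : μ₁ + μ₂ = l₁ + l₂ + d * nsqOn Sᶜ z)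
    (hmul : μ₁ * μ₂ = l₁ * l₂ + d * nsqOn Sᶜ z * l₁ - c ^ 2 * nsqOn S z * nsqOn Sᶜ z) :
    (blockPerturb S l₁ l₂ c d z).charpoly
      = ∏ i, (Polynomial.X - Polynomial.C (twoValued S p q l₁ l₂ μ₁ μ₂ i : ℂ)) := by
  refine Polynomial.eq_of_infinite_eval_eq _ _
    (((Set.toFinite {(l₁ : ℂ), (l₂ : ℂ)}).infinite_compl).mono fun x hx => ?_)
  simp only [Set.mem_compl_iff, Set.mem_insert_iff, Set.mem_singleton_iff, not_or] at hx
  have h₁ := sub_ne_zero.2 hx.1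
  have h₂ := sub_ne_zero.2 hx.2
  have hpq : q ≠ p := fun h => hq (h ▸ hp)
  have hsplit : ∀ f : Fin n → ℂ,
      ∏ i, f i = f p * (f q * ∏ i ∈ (Finset.univ.erase p).erase q, f i) := fun f => by
    rw [Finset.mul_prod_erase _ f (Finset.mem_erase.2 ⟨hpq, Finset.mem_univ q⟩),
      Finset.mul_prod_erase _ f (Finset.mem_univ p)]
  rw [Set.mem_ofPred_eq, Matrix.eval_charpoly, det_scalar_sub_blockPerturb S l₁ l₂ c d z h₁ h₂,
    Polynomial.eval_prod]
  simp only [Polynomial.eval_sub, Polynomial.eval_X, Polynomial.eval_C]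
  rw [hsplit, hsplit fun i => x - (twoValued S p q l₁ l₂ μ₁ μ₂ i : ℂ)]
  have hrest : ∏ i ∈ (Finset.univ.erase p).erase q, (x - (twoValued S p q l₁ l₂ μ₁ μ₂ i : ℂ))
      = ∏ i ∈ (Finset.univ.erase p).erase q, (x - if i ∈ S then (l₁ : ℂ) else l₂) := by
    refine Finset.prod_congr rfl fun i hi => ?_
    simp only [Finset.mem_erase] at hi
    by_cases hS : i ∈ S <;> simp [twoValued, hi.1, hi.2.1, hS]
  have hadd' : (μ₁ : ℂ) + μ₂ = l₁ + l₂ + d * nsqOn Sᶜ z := by exact_mod_cast hadd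
  have hmul' : (μ₁ : ℂ) * μ₂ = l₁ * l₂ + d * nsqOn Sᶜ z * l₁ - c ^ 2 * nsqOn S z * nsqOn Sᶜ z := by
    exact_mod_cast hmul
  rw [hrest]
  generalize ∏ i ∈ (Finset.univ.erase p).erase q, (x - if i ∈ S then (l₁ : ℂ) else l₂) = P
  simp only [twoValued, hp, hq, hpq, if_true, if_false]
  field_simp
  linear_combination P * x * hadd' - P * hmul'

end Eigenvalues

section ReducedProduct

variable {n : ℕ}

/-- The sum of `σ • c` over `T ∩ S` and of `c` over `T \ S`, divided by `σ` if `T ⊆ S`. -/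
def reducedSum (S T : Finset (Fin n)) (σ : ℝ) (c : Fin n → ℝ) : ℝ :=
  if T ⊆ S then ∑ i ∈ T, c i else ∑ i ∈ T, if i ∈ S then σ * c i else c i

lemma reducedSum_pos {S T : Finset (Fin n)} (hT : T.Nonempty) {σ : ℝ} (hσ : 0 ≤ σ)
    {c : Fin n → ℝ} (hc : ∀ i, 0 < c i) : 0 < reducedSum S T σ c := by
  rw [reducedSum]
  split_ifs with h
  · exact Finset.sum_pos (fun i _ => hc i) hT
  · obtain ⟨i, hiT, hiS⟩ := Finset.not_subset.1 h
    refine Finset.sum_pos' (fun j _ => ?_) ⟨i, hiT, ?_⟩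
    · split_ifs
      · exact mul_nonneg hσ (hc j).le
      · exact (hc j).le
    · rw [if_neg hiS]
      exact hc i

lemma sum_eq_mul_reducedSum (S T : Finset (Fin n)) (σ g : ℝ) (c : Fin n → ℝ) :
    ∑ i ∈ T, g * (if i ∈ S then σ * c i else c i)
      = (if T ⊆ S then σ * g else g) * reducedSum S T σ c := by
  rw [reducedSum]
  split_ifs with h
  · rw [Finset.mul_sum]
    exact Finset.sum_congr rfl fun i hi => by rw [if_pos (h hi)]; ring
  · rw [Finset.mul_sum]

lemma prod_ite_subset (S : Finset (Fin n)) (k : ℕ) (x y : ℝ) :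
    ∏ T ∈ Finset.powersetCard k (Finset.univ : Finset (Fin n)), (if T ⊆ S then x else y)
      = x ^ (S.card.choose k) * y ^ (n.choose k - S.card.choose k) := by
  rw [Finset.prod_ite, Finset.prod_const, Finset.prod_const]
  have h : (Finset.powersetCard k (Finset.univ : Finset (Fin n))).filter (· ⊆ S)
      = Finset.powersetCard k S := by
    ext T
    simp [Finset.mem_powersetCard, and_comm]
  have h' := Finset.card_filter_add_card_filter_not (s := Finset.powersetCard k Finset.univ) (· ⊆ S)
  rw [h, Finset.card_powersetCard, Finset.card_powersetCard, Finset.card_fin] at h'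
  rw [h, Finset.card_powersetCard, ← h', Nat.add_sub_cancel_left]

section Smooth

variable {E : Type*} [NormedAddCommGroup E] [NormedSpace ℝ E] {S : Finset (Fin n)} {p q : Fin n}
  {σ l₁ l₂ μ₁ μ₂ : E → ℝ}

lemma sum_twoValued_congr {A : Finset (Fin n)} (hp : p ∉ A) (hq : q ∉ A) (G : Fin n → ℝ → ℝ)
    (a b c d : ℝ) :
    ∑ i ∈ A, G i (twoValued S p q a b c d i) = ∑ i ∈ A, G i (if i ∈ S then a else b) := by
  refine Finset.sum_congr rfl fun i hi => ?_
  rw [twoValued, if_neg (ne_of_mem_of_not_mem hi hp), if_neg (ne_of_mem_of_not_mem hi hq)]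

lemma contDiff_reducedSum_mul_swap (hp : p ∈ S) (hq : q ∉ S)
    (hσ : ContDiff ℝ (⊤ : ℕ∞) σ) (hl₁ : ContDiff ℝ (⊤ : ℕ∞) l₁) (hl₂ : ContDiff ℝ (⊤ : ℕ∞) l₂)
    (hadd : ContDiff ℝ (⊤ : ℕ∞) fun x => σ x * μ₁ x + μ₂ x)
    (hmul : ContDiff ℝ (⊤ : ℕ∞) fun x => μ₁ x * μ₂ x) (T : Finset (Fin n)) :
    ContDiff ℝ (⊤ : ℕ∞) fun x =>
      reducedSum S T (σ x) (twoValued S p q (l₁ x) (l₂ x) (μ₁ x) (μ₂ x))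
        * reducedSum S (T.map (Equiv.swap p q).toEmbedding) (σ x)
            (twoValued S p q (l₁ x) (l₂ x) (μ₁ x) (μ₂ x)) := by
  have hpq : q ≠ p := fun h => hq (h ▸ hp)
  obtain ⟨A, hA⟩ : ∃ A, A = (T.erase p).erase q := ⟨_, rfl⟩
  have hpA : p ∉ A := by simp [hA]
  have hqA : q ∉ A := by simp [hA]
  have hmap : A.map (Equiv.swap p q).toEmbedding = A := by
    refine Finset.eq_of_subset_of_card_le (fun i hi => ?_) (by rw [Finset.card_map])
    obtain ⟨j, hj, rfl⟩ := Finset.mem_map.1 hi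
    rw [Equiv.coe_toEmbedding, Equiv.swap_apply_of_ne_of_ne (ne_of_mem_of_not_mem hj hpA)
      (ne_of_mem_of_not_mem hj hqA)]
    exact hj
  have hswapp : (Equiv.swap p q).toEmbedding p = q := Equiv.swap_apply_left p q
  have hswapq : (Equiv.swap p q).toEmbedding q = p := Equiv.swap_apply_right p q
  let X : E → ℝ := fun x => ∑ i ∈ A, if i ∈ S then l₁ x else l₂ x
  let Y : E → ℝ := fun x => ∑ i ∈ A,
    if i ∈ S then σ x * (if i ∈ S then l₁ x else l₂ x) else if i ∈ S then l₁ x else l₂ x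
  have hX : ContDiff ℝ (⊤ : ℕ∞) X := ContDiff.sum fun i _ => by split_ifs <;> assumption
  have hY : ContDiff ℝ (⊤ : ℕ∞) Y := ContDiff.sum fun i _ => by
    split_ifs
    · exact hσ.mul hl₁
    · exact hl₂
  have hYX : A ⊆ S → ∀ x, Y x = σ x * X x := fun h x => by
    simp only [X, Y, Finset.mul_sum]
    exact Finset.sum_congr rfl fun i hi => by rw [if_pos (h hi)]
  have sX : ∀ x, ∑ i ∈ A, twoValued S p q (l₁ x) (l₂ x) (μ₁ x) (μ₂ x) i = X x := fun x =>
    sum_twoValued_congr hpA hqA (fun _ t => t) _ _ _ _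
  have sY : ∀ x, (∑ i ∈ A, if i ∈ S then σ x * twoValued S p q (l₁ x) (l₂ x) (μ₁ x) (μ₂ x) i
      else twoValued S p q (l₁ x) (l₂ x) (μ₁ x) (μ₂ x) i) = Y x := fun x =>
    sum_twoValued_congr hpA hqA (fun i t => if i ∈ S then σ x * t else t) _ _ _ _
  have vp : ∀ x, twoValued S p q (l₁ x) (l₂ x) (μ₁ x) (μ₂ x) p = μ₁ x := fun x => by
    simp [twoValued]
  have vq : ∀ x, twoValued S p q (l₁ x) (l₂ x) (μ₁ x) (μ₂ x) q = μ₂ x := fun x => by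
    simp [twoValued, hpq]
  have r0 : ∀ x, reducedSum S A (σ x) (twoValued S p q (l₁ x) (l₂ x) (μ₁ x) (μ₂ x))
      = if A ⊆ S then X x else Y x := fun x => by rw [reducedSum, sX, sY]
  have rp : ∀ x, reducedSum S (insert p A) (σ x) (twoValued S p q (l₁ x) (l₂ x) (μ₁ x) (μ₂ x))
      = if A ⊆ S then μ₁ x + X x else σ x * μ₁ x + Y x := fun x => by
    rw [reducedSum, Finset.sum_insert hpA, Finset.sum_insert hpA, sX, sY, vp, if_pos hp]
    simp [Finset.insert_subset_iff, hp]
  have rq : ∀ x, reducedSum S (insert q A) (σ x) (twoValued S p q (l₁ x) (l₂ x) (μ₁ x) (μ₂ x))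
      = μ₂ x + Y x := fun x => by
    rw [reducedSum, Finset.sum_insert hqA, Finset.sum_insert hqA, sX, sY, vq, if_neg hq]
    simp [Finset.insert_subset_iff, hq]
  have hpqA : p ∉ insert q A := by simp [hpq.symm, hpA]
  have rpq : ∀ x, reducedSum S (insert p (insert q A)) (σ x)
      (twoValued S p q (l₁ x) (l₂ x) (μ₁ x) (μ₂ x)) = (σ x * μ₁ x + μ₂ x) + Y x := fun x => by
    rw [reducedSum, Finset.sum_insert hpqA, Finset.sum_insert hpqA, Finset.sum_insert hqA,
      Finset.sum_insert hqA, sX, sY, vp, vq, if_pos hp, if_neg hq]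
    simp [Finset.insert_subset_iff, hq, add_assoc]
  have hmix : ContDiff ℝ (⊤ : ℕ∞) fun x =>
      (if A ⊆ S then μ₁ x + X x else σ x * μ₁ x + Y x) * (μ₂ x + Y x) := by
    by_cases hAS : A ⊆ S
    · simp only [if_pos hAS]
      have h : (fun x => (μ₁ x + X x) * (μ₂ x + Y x))
          = fun x => μ₁ x * μ₂ x + X x * (σ x * μ₁ x + μ₂ x) + X x * Y x := by
        funext x
        rw [hYX hAS]
        ring
      rw [h]
      exact (hmul.add (hX.mul hadd)).add (hX.mul hY)
    · simp only [if_neg hAS]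
      have h : (fun x => (σ x * μ₁ x + Y x) * (μ₂ x + Y x))
          = fun x => σ x * (μ₁ x * μ₂ x) + Y x * (σ x * μ₁ x + μ₂ x) + Y x * Y x := by
        funext x
        ring
      rw [h]
      exact ((hσ.mul hmul).add (hY.mul hadd)).add (hY.mul hY)
  by_cases hpT : p ∈ T <;> by_cases hqT : q ∈ T
  · have hT : T = insert p (insert q A) := by
      rw [hA, Finset.insert_erase (Finset.mem_erase.2 ⟨hpq, hqT⟩), Finset.insert_erase hpT]
    have hT' : T.map (Equiv.swap p q).toEmbedding = T := by
      rw [hT, Finset.map_insert, Finset.map_insert, hmap, hswapp, hswapq, Finset.insert_comm]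
    rw [hT', hT]
    simp only [rpq]
    exact (hadd.add hY).mul (hadd.add hY)
  · have hT : T = insert p A := by
      rw [hA, Finset.erase_eq_of_notMem (by simp [hqT]), Finset.insert_erase hpT]
    rw [hT, Finset.map_insert, hmap, hswapp]
    simp only [rp, rq]
    exact hmix
  · have hT : T = insert q A := by
      rw [hA, Finset.erase_eq_of_notMem hpT, Finset.insert_erase hqT]
    rw [hT, Finset.map_insert, hmap, hswapq]
    simp only [rp, rq]
    simpa only [mul_comm] using hmix
  · have hT : T = A := by
      rw [hA, Finset.erase_eq_of_notMem hpT, Finset.erase_eq_of_notMem hqT]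
    rw [hT, hmap]
    simp only [r0]
    by_cases hAS : A ⊆ S
    · simp only [if_pos hAS]
      exact hX.mul hX
    · simp only [if_neg hAS]
      exact hY.mul hY

lemma contDiff_prod_reducedSum (hp : p ∈ S) (hq : q ∉ S)
    (hσ : ContDiff ℝ (⊤ : ℕ∞) σ) (hl₁ : ContDiff ℝ (⊤ : ℕ∞) l₁) (hl₂ : ContDiff ℝ (⊤ : ℕ∞) l₂)
    (hadd : ContDiff ℝ (⊤ : ℕ∞) fun x => σ x * μ₁ x + μ₂ x)
    (hmul : ContDiff ℝ (⊤ : ℕ∞) fun x => μ₁ x * μ₂ x) (k : ℕ)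
    (hpos : ∀ x, 0 < ∏ T ∈ Finset.powersetCard k (Finset.univ : Finset (Fin n)),
      reducedSum S T (σ x) (twoValued S p q (l₁ x) (l₂ x) (μ₁ x) (μ₂ x))) :
    ContDiff ℝ (⊤ : ℕ∞) fun x => ∏ T ∈ Finset.powersetCard k (Finset.univ : Finset (Fin n)),
      reducedSum S T (σ x) (twoValued S p q (l₁ x) (l₂ x) (μ₁ x) (μ₂ x)) := by
  have hsq : ∀ x, (∏ T ∈ Finset.powersetCard k (Finset.univ : Finset (Fin n)),
        reducedSum S T (σ x) (twoValued S p q (l₁ x) (l₂ x) (μ₁ x) (μ₂ x))) ^ 2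
      = ∏ T ∈ Finset.powersetCard k (Finset.univ : Finset (Fin n)),
        (reducedSum S T (σ x) (twoValued S p q (l₁ x) (l₂ x) (μ₁ x) (μ₂ x))
          * reducedSum S (T.map (Equiv.swap p q).toEmbedding) (σ x)
            (twoValued S p q (l₁ x) (l₂ x) (μ₁ x) (μ₂ x))) := fun x => by
    rw [sq, Finset.prod_mul_distrib]
    congr 1
    symm
    refine Finset.prod_equiv (Equiv.swap p q).finsetCongr (fun T => ?_) fun T _ => rfl
    simp [Finset.mem_powersetCard]
  have hcd := contDiff_prod (t := Finset.powersetCard k (Finset.univ : Finset (Fin n)))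
    fun T _ => contDiff_reducedSum_mul_swap hp hq hσ hl₁ hl₂ hadd hmul T
  simp only [← hsq] at hcd
  simpa only [Real.sqrt_sq (hpos _).le] using hcd.sqrt fun x => (pow_pos (hpos x) 2).ne'

end Smooth

end ReducedProduct

section Main

variable {n : ℕ}

/-- The larger root of `X² - (σ + aβ²) X + β²σ`. -/
def largeRoot (β a σ : ℝ) : ℝ :=
  (σ + a * β ^ 2 + Real.sqrt ((σ + a * β ^ 2) ^ 2 - 4 * β ^ 2 * σ)) / 2

lemma largeRoot_pos {β a σ : ℝ} (hβ : 0 < β) (ha : 1 ≤ a) (hσ : 0 ≤ σ) : 0 < largeRoot β a σ := by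
  have : 0 < σ + a * β ^ 2 := by positivity
  unfold largeRoot
  positivity

lemma mul_div_largeRoot_add {β a σ : ℝ} (hβ : 0 < β) (ha : 1 ≤ a) (hσ : 0 ≤ σ) :
    σ * (β ^ 2 / largeRoot β a σ) + largeRoot β a σ = σ + a * β ^ 2 := by
  have h := largeRoot_pos hβ ha hσ
  have hdisc : 0 ≤ (σ + a * β ^ 2) ^ 2 - 4 * β ^ 2 * σ := by
    have h1 : σ + β ^ 2 ≤ σ + a * β ^ 2 := by nlinarith [sq_nonneg β]
    have h2 : (σ + β ^ 2) ^ 2 ≤ (σ + a * β ^ 2) ^ 2 := by gcongr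
    nlinarith [sq_nonneg (σ - β ^ 2)]
  have hs := Real.sq_sqrt hdisc
  field_simp
  unfold largeRoot
  linarith

/-- The smooth positive factor of `MA_k` of the complex Hessian of `prodPow S Sᶜ β`. -/
def smoothFactor (S : Finset (Fin n)) (p q : Fin n) (k : ℕ) (β : ℝ) (z : Fin n → ℂ) : ℝ :=
  ∏ T ∈ Finset.powersetCard k (Finset.univ : Finset (Fin n)),
    reducedSum S T (nsqOn Sᶜ z) (twoValued S p q 1 ((1 + nsqOn S z) * β)
      (β ^ 2 / largeRoot β (1 + nsqOn S z) (nsqOn Sᶜ z))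
      (largeRoot β (1 + nsqOn S z) (nsqOn Sᶜ z)))

lemma one_le_one_add_nsqOn (S : Finset (Fin n)) (z : Fin n → ℂ) : 1 ≤ 1 + nsqOn S z :=
  le_add_of_nonneg_right (nsqOn_nonneg S z)

lemma smoothFactor_pos (S : Finset (Fin n)) (p q : Fin n) {k : ℕ} (hk : 1 ≤ k) {β : ℝ} (hβ : 0 < β)
    (z : Fin n → ℂ) : 0 < smoothFactor S p q k β z := by
  have ha := one_le_one_add_nsqOn S z
  have hr := largeRoot_pos hβ ha (nsqOn_nonneg Sᶜ z)
  refine Finset.prod_pos fun T hT => reducedSum_pos ?_ (nsqOn_nonneg _ _) fun i => ?_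
  · rw [← Finset.card_pos, (Finset.mem_powersetCard.1 hT).2]
    exact hk
  · unfold twoValued
    split_ifs <;> positivity

lemma contDiff_smoothFactor {S : Finset (Fin n)} {p q : Fin n} (hp : p ∈ S) (hq : q ∉ S) {k : ℕ}
    (hk : 1 ≤ k) {β : ℝ} (hβ : 0 < β) : ContDiff ℝ (⊤ : ℕ∞) (smoothFactor S p q k β) := by
  have hσ := contDiff_nsqOn Sᶜ
  have ha : ContDiff ℝ (⊤ : ℕ∞) fun z => 1 + nsqOn S z := contDiff_const.add (contDiff_nsqOn S)
  refine contDiff_prod_reducedSum hp hq hσ contDiff_const (ha.mul contDiff_const) ?_ ?_ k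
    (smoothFactor_pos S p q hk hβ)
  · simp only [mul_div_largeRoot_add hβ (one_le_one_add_nsqOn S _) (nsqOn_nonneg Sᶜ _)]
    exact hσ.add (ha.mul contDiff_const)
  · simp only [div_mul_cancel₀ _
      (largeRoot_pos hβ (one_le_one_add_nsqOn S _) (nsqOn_nonneg Sᶜ _)).ne']
    exact contDiff_const

lemma MAk_prodPow {S : Finset (Fin n)} {p q : Fin n} (hp : p ∈ S) (hq : q ∉ S) (k : ℕ)
    {β : ℝ} (hβ : 0 < β) {z : Fin n → ℂ} (hz : 0 < nsqOn Sᶜ z) :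
    MAk n k (sortedEigs (complexHessian (prodPow S Sᶜ β) z)) = smoothFactor S p q k β z
      * Real.sqrt (nsqOn Sᶜ z) ^ (2 * β * (S.card.choose k : ℝ)
          + (2 * β - 2) * ((n.choose k : ℝ) - (S.card.choose k : ℝ))) := by
  obtain ⟨σ, hσ⟩ : ∃ σ, σ = nsqOn Sᶜ z := ⟨_, rfl⟩
  obtain ⟨g, hg⟩ : ∃ g, g = nsqOn Sᶜ z ^ (β - 1) := ⟨_, rfl⟩
  obtain ⟨r, hr⟩ : ∃ r, r = largeRoot β (1 + nsqOn S z) (nsqOn Sᶜ z) := ⟨_, rfl⟩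
  have hrpos : 0 < r := hr ▸ largeRoot_pos hβ (one_le_one_add_nsqOn S z) hz.le
  have hradd : σ * (β ^ 2 / r) + r = σ + (1 + nsqOn S z) * β ^ 2 := by
    rw [hr, hσ]
    exact mul_div_largeRoot_add hβ (one_le_one_add_nsqOn S z) hz.le
  have hg1 : nsqOn Sᶜ z ^ β = σ * g := by
    rw [hσ, hg, ← Real.rpow_one_add' hz.le (by linarith)]
    congr 1
    ring
  have hg2 : nsqOn Sᶜ z ^ (β - 2) * nsqOn Sᶜ z = g := by
    rw [hg, ← Real.rpow_add_one hz.ne']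
    congr 1
    ring
  have hH : complexHessian (prodPow S Sᶜ β) z
      = blockPerturb S (nsqOn Sᶜ z ^ β) ((1 + nsqOn S z) * β * nsqOn Sᶜ z ^ (β - 1))
        (β * nsqOn Sᶜ z ^ (β - 1)) ((1 + nsqOn S z) * β * (β - 1) * nsqOn Sᶜ z ^ (β - 2)) z := by
    ext i j
    exact complexHessian_prodPow disjoint_compl_right (Finset.union_compl S) β hz i j
  have hdσ : (1 + nsqOn S z) * β * (β - 1) * nsqOn Sᶜ z ^ (β - 2) * nsqOn Sᶜ z
      = (1 + nsqOn S z) * β * (β - 1) * g := by rw [mul_assoc, hg2]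
  have hchar := charpoly_blockPerturb hp hq (nsqOn Sᶜ z ^ β)
    ((1 + nsqOn S z) * β * nsqOn Sᶜ z ^ (β - 1)) (β * nsqOn Sᶜ z ^ (β - 1))
    ((1 + nsqOn S z) * β * (β - 1) * nsqOn Sᶜ z ^ (β - 2)) z
    (μ₁ := g * (σ * (β ^ 2 / r))) (μ₂ := g * r)
    (by rw [hdσ, hg1, ← hg]; linear_combination g * hradd)
    (by
      rw [hdσ, hg1, ← hg, ← hσ]
      field_simp
      ring)
  have hlam : ∀ i, twoValued S p q (nsqOn Sᶜ z ^ β) ((1 + nsqOn S z) * β * nsqOn Sᶜ z ^ (β - 1))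
      (g * (σ * (β ^ 2 / r))) (g * r) i
      = g * if i ∈ S then σ * twoValued S p q 1 ((1 + nsqOn S z) * β) (β ^ 2 / r) r i
          else twoValued S p q 1 ((1 + nsqOn S z) * β) (β ^ 2 / r) r i := by
    intro i
    rw [hg1, ← hg]
    by_cases hip : i = p
    · subst hip
      simp [twoValued, hp]
    · by_cases hiq : i = q
      · subst hiq
        simp [twoValued, hip, hq]
      · by_cases hi : i ∈ S <;> simp [twoValued, hip, hiq, hi] <;> ring
  have hle : S.card.choose k ≤ n.choose k :=
    Nat.choose_le_choose k ((Finset.card_le_univ S).trans_eq (Fintype.card_fin n))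
  rw [hH, MAk_sortedEigs k (isHermitian_blockPerturb S _ _ _ _ z) hchar, MAk]
  simp only [hlam, sum_eq_mul_reducedSum]
  rw [Finset.prod_mul_distrib, prod_ite_subset, smoothFactor, ← hr, ← hσ, mul_comm]
  congr 1
  have hexp : 2 * β * (S.card.choose k : ℝ)
      + (2 * β - 2) * ((n.choose k : ℝ) - (S.card.choose k : ℝ))
      = 2 * (β * (S.card.choose k : ℝ)
        + (β - 1) * ((n.choose k - S.card.choose k : ℕ) : ℝ)) := by
    rw [Nat.cast_sub hle]
    ring
  rw [hexp, sqrt_rpow_two_mul (hσ ▸ hz.le), Real.rpow_add (hσ ▸ hz), Real.rpow_mul (hσ ▸ hz.le),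
    Real.rpow_mul (hσ ▸ hz.le), Real.rpow_natCast, Real.rpow_natCast, ← hg1, hg, hσ]

end Main

/-- Let `1 ≤ m < n`, `k ∈ {1,…,n−1}`, `β₀ = 1 − C_m^k/C_n^k` (with
`C_m^k = 0` if `m < k`) and `u(z',z'') = (1+|z'|²)|z''|^{2β}`. For `β = β₀` there is a
smooth strictly positive `ψ` on `ℂⁿ` with `MA_k(λ(D²_ℂ u)) = ψ` off `N = {z'' = 0}`
(so `MA_k(λ(D²_ℂ u))` extends to a smooth strictly positive function on `ℂⁿ`); and more
generally, for every `β > 0` there is a smooth strictly positive `ψ` on `ℂⁿ` with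
`MA_k(λ(D²_ℂ u)) = ψ(z)·|z''|^{2βC_m^k + (2β−2)(C_n^k − C_m^k)}` off `N`. -/
theorem pogorelov_MAk (n m k : ℕ) (hm : 1 ≤ m) (hmn : m < n)
    (hk1 : 1 ≤ k) (hkn : k ≤ n - 1) :
    (∃ ψ : (Fin n → ℂ) → ℝ, ContDiff ℝ (⊤ : ℕ∞) ψ ∧ (∀ z, 0 < ψ z) ∧
      ∀ z ∉ singSet n m,
        MAk n k (sortedEigs
            (complexHessian (pogorelov (n := n) m (1 - (m.choose k : ℝ) / (n.choose k : ℝ))) z))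
          = ψ z) ∧
    (∀ β : ℝ, 0 < β → ∃ ψ : (Fin n → ℂ) → ℝ, ContDiff ℝ (⊤ : ℕ∞) ψ ∧ (∀ z, 0 < ψ z) ∧
      ∀ z ∉ singSet n m,
        MAk n k (sortedEigs (complexHessian (pogorelov (n := n) m β) z))
          = ψ z * Real.sqrt (nsqLast m z)
              ^ (2 * β * (m.choose k : ℝ)
                  + (2 * β - 2) * ((n.choose k : ℝ) - (m.choose k : ℝ)))) := by
  let S : Finset (Fin n) := Finset.univ.filter fun i : Fin n => (i : ℕ) < m
  have hSc : Finset.univ.filter (fun i : Fin n => m ≤ (i : ℕ)) = Sᶜ := by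
    ext i
    simp [S]
  have hcard : S.card = m := by
    rw [Fin.card_filter_val_lt, min_eq_right hmn.le]
  have hlast : ∀ z : Fin n → ℂ, nsqLast m z = nsqOn Sᶜ z := fun z => by
    rw [nsqLast, hSc, nsqOn]
  have hpog : ∀ β : ℝ, pogorelov (n := n) m β = prodPow S Sᶜ β := fun β => by
    funext z
    rw [pogorelov, hlast]
    rfl
  let p : Fin n := ⟨0, hm.trans hmn.le⟩
  let q : Fin n := ⟨m, hmn⟩
  have hp : p ∈ S := by simpa [S, p] using Nat.lt_of_succ_le hm
  have hq : q ∉ S := by simp [S, q]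
  have hpos : ∀ z ∉ singSet n m, 0 < nsqOn Sᶜ z := fun z hz => by
    simp only [singSet, Set.mem_ofPred_eq, not_forall] at hz
    obtain ⟨i, hi, hzi⟩ := hz
    exact Finset.sum_pos' (fun j _ => Complex.normSq_nonneg _)
      ⟨i, hSc ▸ by simpa using hi, Complex.normSq_pos.2 hzi⟩
  have hgen : ∀ β : ℝ, 0 < β → ∀ z ∉ singSet n m,
      MAk n k (sortedEigs (complexHessian (pogorelov (n := n) m β) z))
        = smoothFactor S p q k β z * Real.sqrt (nsqLast m z)
            ^ (2 * β * (m.choose k : ℝ)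
                + (2 * β - 2) * ((n.choose k : ℝ) - (m.choose k : ℝ))) := fun β hβ z hz => by
    rw [hpog, hlast, MAk_prodPow hp hq k hβ (hpos z hz), hcard]
  refine ⟨?_, fun β hβ => ⟨smoothFactor S p q k β, contDiff_smoothFactor hp hq hk1 hβ,
    smoothFactor_pos S p q hk1 hβ, hgen β hβ⟩⟩
  have hchoose : m.choose k < n.choose k := by
    have h1 : m.choose k ≤ (n - 1).choose k := Nat.choose_le_choose k (Nat.le_sub_one_of_lt hmn)
    have h2 : n.choose k = (n - 1).choose (k - 1) + (n - 1).choose k :=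
      Nat.choose_eq_choose_pred_add (by omega) hk1
    have h3 : 0 < (n - 1).choose (k - 1) := Nat.choose_pos (by omega)
    omega
  have hC : (0 : ℝ) < n.choose k := by exact_mod_cast (Nat.zero_le _).trans_lt hchoose
  have hβ : 0 < 1 - (m.choose k : ℝ) / (n.choose k : ℝ) := by
    rw [sub_pos, div_lt_one hC]
    exact_mod_cast hchoose
  refine ⟨smoothFactor S p q k _, contDiff_smoothFactor hp hq hk1 hβ,
    smoothFactor_pos S p q hk1 hβ, fun z hz => ?_⟩
  have hexp : 2 * (1 - (m.choose k : ℝ) / (n.choose k : ℝ)) * (m.choose k : ℝ)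
      + (2 * (1 - (m.choose k : ℝ) / (n.choose k : ℝ)) - 2)
        * ((n.choose k : ℝ) - (m.choose k : ℝ)) = 0 := by
    field_simp
    ring
  rw [hgen _ hβ z hz, hexp, Real.rpow_zero, mul_one]
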